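/- Let V be a Banach 𝕆-bimodule, T a power-associative bounded right para-linear operator on V, J ∈ 𝕊 and s ∈ ℂ_J with |s| > ‖T‖. Then for every integer m ≥ 1 and every v ∈ V, π_J(∑_{n≥0} C(m+n−1, m−1) · Tⁿ(v·s^{−m−n})) = π_J((R_s − T)^{−m}(v)), where the series converges in norm and C(·,·) denotes binomial coefficients. In particular, (R_s − T)^{−1} is ℂ_J-liftable power associative. -/

import Mathlib

noncomputable section

open scoped BigOperators

/-- Octonions, realized via the Cayley–Dickson doubling of the quaternions. -/
@[ext]
structure Oct : Type where
  a : Quaternion ℝ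
  b : Quaternion ℝ

namespace Oct

instance : Zero Oct := ⟨⟨0, 0⟩⟩
instance : Add Oct := ⟨fun x y => ⟨x.a + y.a, x.b + y.b⟩⟩
instance : Neg Oct := ⟨fun x => ⟨-x.a, -x.b⟩⟩
instance : Sub Oct := ⟨fun x y => ⟨x.a - y.a, x.b - y.b⟩⟩
instance : SMul ℕ Oct := ⟨fun n x => ⟨n • x.a, n • x.b⟩⟩
instance : SMul ℤ Oct := ⟨fun n x => ⟨n • x.a, n • x.b⟩⟩
instance : SMul ℝ Oct := ⟨fun r x => ⟨r • x.a, r • x.b⟩⟩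

def toLp (x : Oct) : WithLp 2 (Quaternion ℝ × Quaternion ℝ) :=
  (WithLp.equiv 2 (Quaternion ℝ × Quaternion ℝ)).symm (x.a, x.b)

lemma toLp_injective : Function.Injective toLp := by
  rintro ⟨xa, xb⟩ ⟨ya, yb⟩ h
  have ha : xa = ya :=
    congrArg (fun z => (WithLp.equiv 2 (Quaternion ℝ × Quaternion ℝ) z).1) h
  have hb : xb = yb :=
    congrArg (fun z => (WithLp.equiv 2 (Quaternion ℝ × Quaternion ℝ) z).2) h
  subst ha; subst hb; rfl

instance : AddCommGroup Oct :=
  toLp_injective.addCommGroup toLp rfl (fun _ _ => rfl) (fun _ => rfl) (fun _ _ => rfl)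
    (fun _ _ => rfl) (fun _ _ => rfl)

def toLpHom : Oct →+ WithLp 2 (Quaternion ℝ × Quaternion ℝ) where
  toFun := toLp
  map_zero' := rfl
  map_add' _ _ := rfl

instance : Module ℝ Oct := toLp_injective.module ℝ toLpHom fun _ _ => rfl

instance : NormedAddCommGroup Oct :=
  NormedAddCommGroup.induced Oct (WithLp 2 (Quaternion ℝ × Quaternion ℝ)) toLpHom toLp_injective

instance : NormedSpace ℝ Oct := ⟨fun r x => norm_smul_le r (toLp x)⟩

def toProdLin : Oct →ₗ[ℝ] Quaternion ℝ × Quaternion ℝ where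
  toFun x := (x.a, x.b)
  map_add' _ _ := rfl
  map_smul' _ _ := rfl

lemma toProdLin_injective : Function.Injective toProdLin := by
  rintro ⟨xa, xb⟩ ⟨ya, yb⟩ h
  have ha : xa = ya := congrArg Prod.fst h
  have hb : xb = yb := congrArg Prod.snd h
  subst ha; subst hb; rfl

instance : FiniteDimensional ℝ Oct :=
  FiniteDimensional.of_injective toProdLin toProdLin_injective

instance : CompleteSpace Oct := FiniteDimensional.complete ℝ Oct

instance : One Oct := ⟨⟨1, 0⟩⟩

instance : Mul Oct :=
  ⟨fun x y => ⟨x.a * y.a - star y.b * x.b, y.b * x.a + x.b * star y.a⟩⟩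

/-- Octonionic conjugation. -/
def conj (x : Oct) : Oct := ⟨star x.a, -x.b⟩

/-- The real part of an octonion. -/
def re (x : Oct) : ℝ := x.a.re

/-- Powers of an octonion (association chosen on the left factor). -/
def opow (s : Oct) : ℕ → Oct
  | 0 => 1
  | n + 1 => s * opow s n

/-- The inverse of a nonzero octonion. -/
def oinv (s : Oct) : Oct := (‖s‖ ^ 2)⁻¹ • conj s

/-- `invPow s n` is the octonion `s ^ (-1 - n)`. -/
def invPow (s : Oct) (n : ℕ) : Oct := opow (oinv s) (n + 1)

def eNat : ℕ → Oct
  | 0 => ⟨1, 0⟩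
  | 1 => ⟨⟨0, 1, 0, 0⟩, 0⟩
  | 2 => ⟨⟨0, 0, 1, 0⟩, 0⟩
  | 3 => ⟨⟨0, 0, 0, 1⟩, 0⟩
  | 4 => ⟨0, 1⟩
  | 5 => ⟨0, ⟨0, 1, 0, 0⟩⟩
  | 6 => ⟨0, ⟨0, 0, 1, 0⟩⟩
  | 7 => ⟨0, ⟨0, 0, 0, 1⟩⟩
  | _ => 0

/-- The standard basis `e_0 = 1, e_1, …, e_7` of the octonions. -/
def e (i : Fin 8) : Oct := eNat i.val

/-- The six-dimensional sphere `𝕊` of imaginary units of `𝕆`. -/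
def unitSphere : Set Oct := {J | J * J = -1}

/-- The slice `ℂ_J = ℝ ⊕ ℝJ` of the octonions. -/
def sliceC (J : Oct) : Set Oct := {s | ∃ x y : ℝ, s = x • (1 : Oct) + y • J}

/-- The embedding of `ℂ` onto the slice `ℂ_J`, `x + y i ↦ x + y J`. -/
def toSlice (J : Oct) (z : ℂ) : Oct := z.re • (1 : Oct) + z.im • J

end Oct

open Oct

/-- A (normed/Banach) `𝕆`-bimodule: a real normed space with continuous real-bilinear left and
right octonionic multiplications satisfying the alternativity relations
`[p,q,x] = [q,x,p] = [x,p,q] = -[q,p,x]` and the norm identities `‖px‖ = |p|‖x‖ = ‖xp‖`. -/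
class OctBimodule (V : Type*) [NormedAddCommGroup V] [NormedSpace ℝ V] : Type _ where
  lm : Oct →ₗ[ℝ] V →L[ℝ] V
  rm : Oct →ₗ[ℝ] V →L[ℝ] V
  lm_one : ∀ x : V, lm 1 x = x
  rm_one : ∀ x : V, rm 1 x = x
  /-- `[p,q,x] = [q,x,p]` -/
  assoc_cyc₁ : ∀ (p q : Oct) (x : V),
    lm (p * q) x - lm p (lm q x) = rm p (lm q x) - lm q (rm p x)
  /-- `[p,q,x] = [x,p,q]` -/
  assoc_cyc₂ : ∀ (p q : Oct) (x : V),
    lm (p * q) x - lm p (lm q x) = rm q (rm p x) - rm (p * q) x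
  /-- `[p,q,x] = -[q,p,x]` -/
  assoc_alt : ∀ (p q : Oct) (x : V),
    lm (p * q) x - lm p (lm q x) = -(lm (q * p) x - lm q (lm p x))
  norm_lm : ∀ (p : Oct) (x : V), ‖lm p x‖ = ‖p‖ * ‖x‖
  norm_rm : ∀ (p : Oct) (x : V), ‖rm p x‖ = ‖p‖ * ‖x‖

section OctMod

variable {V : Type*} [NormedAddCommGroup V] [NormedSpace ℝ V] [OctBimodule V]

/-- Left multiplication `x ↦ p x` as a bounded real-linear operator. -/
def lmo (p : Oct) : V →L[ℝ] V := OctBimodule.lm p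

/-- Right multiplication `R_p : x ↦ x p` as a bounded real-linear operator. -/
def rmo (p : Oct) : V →L[ℝ] V := OctBimodule.rm p

variable (V)

/-- The real-part projection `Re x = (5/12) x - (1/12) ∑_{i=1}^7 e_i x e_i` of an
`𝕆`-bimodule. -/
def reO : V →L[ℝ] V :=
  (5 / 12 : ℝ) • ContinuousLinearMap.id ℝ V -
    (1 / 12 : ℝ) • ∑ i : Fin 7, (rmo (e i.succ)).comp (lmo (e i.succ))

/-- The real part `Re V` of an `𝕆`-bimodule, i.e. the set of associative central elements. -/
def ReSet : Set V :=
  {m | (∀ p q : Oct, lmo (p * q) m = lmo p (lmo q m)) ∧ ∀ p : Oct, lmo p m = rmo p m}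

/-- The slice `ℂ_J(V) = Re V ⊕ J · Re V` of an `𝕆`-bimodule. -/
def CJV (J : Oct) : Set V :=
  {x | ∃ u ∈ ReSet V, ∃ w ∈ ReSet V, x = u + lmo J w}

/-- The slice projection `π_J(x) = Re x + J Re (J̄ x)`. -/
def piJ (J : Oct) : V →L[ℝ] V :=
  reO V + (lmo J).comp ((reO V).comp (lmo (Oct.conj J)))

variable {V}

/-- The second right associator `B_p(T, x) = T(x) p - T(x p)` of an operator. -/
def Bop (p : Oct) (T : V →L[ℝ] V) : V →L[ℝ] V := (rmo p).comp T - T.comp (rmo p)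

/-- A bounded real-linear operator is right (octonionic) para-linear if `Re B_p(T,x) = 0`. -/
def IsRightPara (T : V →L[ℝ] V) : Prop := ∀ (p : Oct) (x : V), reO V (Bop p T x) = 0

/-- The left octonionic scalar multiplication `(p ⊙ T)(x) = p T(x) + B_p(T,x)` on operators. -/
def odotL (p : Oct) (T : V →L[ℝ] V) : V →L[ℝ] V := (lmo p).comp T + Bop p T

/-- The right octonionic scalar multiplication `(T ⊙ p)(x) = T(p x) - B_p(T,x)` on operators. -/
def odotR (T : V →L[ℝ] V) (p : Oct) : V →L[ℝ] V := T.comp (lmo p) - Bop p T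

/-- The lifting map, `(lif F)(x) = ∑_i F(x ē_i) e_i`. -/
def lifO (F : V →L[ℝ] V) : V →L[ℝ] V :=
  ∑ i : Fin 8, (rmo (e i)).comp (F.comp (rmo (Oct.conj (e i))))

/-- The extension map, `(ext G)(∑ x_i e_i) = ∑ G(x_i) e_i`, where `x_i = Re (x ē_i)`. -/
def extO (G : V →L[ℝ] V) : V →L[ℝ] V :=
  ∑ i : Fin 8, (rmo (e i)).comp (G.comp ((reO V).comp (rmo (Oct.conj (e i)))))

/-- The left regular power `T^{n⊚} = lif (Re ∘ Tⁿ)`. -/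
def rpowL (T : V →L[ℝ] V) (n : ℕ) : V →L[ℝ] V := lifO ((reO V).comp (T ^ n))

/-- The right regular power `T^{⊚n} = ext (Tⁿ|_{Re V})`. -/
def rpowR (T : V →L[ℝ] V) (n : ℕ) : V →L[ℝ] V := extO (T ^ n)

/-- The regular composition `f ⊚ g = lif (Re ∘ f ∘ g)`. -/
def rcomp (f g : V →L[ℝ] V) : V →L[ℝ] V := lifO ((reO V).comp (f.comp g))

/-- The composition associator `[f,g,x]_⊚ = (f ⊚ g)(x) - f(g(x))`. -/
def compAssoc (f g : V →L[ℝ] V) (x : V) : V := rcomp f g x - f (g x)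

/-- The right regular inverse `T^{⊚-} = ext (T⁻¹|_{Re V})` of an invertible operator. -/
def rinvR (T : V →L[ℝ] V) : V →L[ℝ] V := extO (Ring.inverse T)

/-- The left regular inverse `T^{-⊚} = lif (Re ∘ T⁻¹)` of an invertible operator. -/
def rinvL (T : V →L[ℝ] V) : V →L[ℝ] V := lifO ((reO V).comp (Ring.inverse T))

/-- An operator is power-associative if all of its (composition) powers are right
para-linear. -/
def IsPowerAssoc (T : V →L[ℝ] V) : Prop := ∀ n : ℕ, IsRightPara (T ^ n)

/-- A bounded operator is octonionic linear if `T(xp) = T(x)p` for all `p`. -/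
def IsOctLinear (T : V →L[ℝ] V) : Prop := ∀ (p : Oct) (x : V), T (rmo p x) = rmo p (T x)

/-- `S` is `ℂ_J`-extendable power associative: `Sⁿ(v s) = Sⁿ(v) s` for `v ∈ Re V`,
`s ∈ ℂ_J`, `n ≥ 1`. -/
def CJExtPA (J : Oct) (S : V →L[ℝ] V) : Prop :=
  ∀ n : ℕ, 1 ≤ n → ∀ v ∈ ReSet V, ∀ s ∈ sliceC J, (S ^ n) (rmo s v) = rmo s ((S ^ n) v)

/-- `S` is `ℂ_J`-liftable power associative: `Re (Sⁿ(v s)) = Re (Sⁿ(v) s)` for all `v ∈ V`,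
`s ∈ ℂ_J`, `n ≥ 1`. -/
def CJLiftPA (J : Oct) (S : V →L[ℝ] V) : Prop :=
  ∀ n : ℕ, 1 ≤ n → ∀ (v : V), ∀ s ∈ sliceC J,
    reO V ((S ^ n) (rmo s v)) = reO V (rmo s ((S ^ n) v))

/-- The pull-back slice-resolvent set `ρ*_J(T)`. -/
def pbResSlice (T : V →L[ℝ] V) (J : Oct) : Set Oct :=
  {s | s ∈ sliceC J ∧ IsUnit ((rmo s : V →L[ℝ] V) - T) ∧
    CJExtPA J (Ring.inverse ((rmo s : V →L[ℝ] V) - T))}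

/-- The pull-back resolvent set `ρ*(T)`. -/
def pbRes (T : V →L[ℝ] V) : Set Oct := ⋃ J ∈ unitSphere, pbResSlice T J

/-- The pull-back spectrum `σ*(T) = 𝕆 ∖ ρ*(T)`. -/
def pbSpec (T : V →L[ℝ] V) : Set Oct := Set.univ \ pbRes T

/-- The push-forward slice-resolvent set `ρ_{*J}(T)`. -/
def pfResSlice (T : V →L[ℝ] V) (J : Oct) : Set Oct :=
  {s | s ∈ sliceC J ∧ IsUnit ((rmo s : V →L[ℝ] V) - T) ∧
    CJLiftPA J (Ring.inverse ((rmo s : V →L[ℝ] V) - T))}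

/-- The push-forward resolvent set `ρ_*(T)`. -/
def pfRes (T : V →L[ℝ] V) : Set Oct := ⋃ J ∈ unitSphere, pfResSlice T J

/-- The push-forward spectrum `σ_*(T) = 𝕆 ∖ ρ_*(T)`. -/
def pfSpec (T : V →L[ℝ] V) : Set Oct := Set.univ \ pfRes T

/-- The real-part projection of the `𝕆`-bimodule `𝓑_RO(V)` of bounded right para-linear
operators, given by `Re A = (5/12) A - (1/12) ∑_{i=1}^7 (e_i ⊙ A) ⊙ e_i`. -/
def reOpB (A : V →L[ℝ] V) : V →L[ℝ] V :=
  (5 / 12 : ℝ) • A - (1 / 12 : ℝ) • ∑ i : Fin 7, odotR (odotL (e i.succ) A) (e i.succ)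

end OctMod

/-- A set `U ⊆ 𝕆` is slice-open if `U ∩ ℂ_J` is open in `ℂ_J` for every `J ∈ 𝕊`. -/
def SliceOpen (U : Set Oct) : Prop :=
  ∀ J ∈ unitSphere, IsOpen (Oct.toSlice J ⁻¹' U)

/-- A parametrization of the boundary `∂(U ∩ ℂ_J)` by finitely many continuously
differentiable, positively oriented Jordan curves (positivity of the orientation is encoded
through the winding numbers). -/
structure SliceContour (J : Oct) (U : Set Oct) where
  n : ℕ
  γ : Fin n → ℝ → ℂ
  smooth : ∀ i, ContDiff ℝ 1 (γ i)
  closed : ∀ i, γ i 0 = γ i 1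
  jordan : ∀ i, Set.InjOn (γ i) (Set.Ico (0 : ℝ) 1)
  image_eq : (⋃ i, γ i '' Set.Icc (0 : ℝ) 1) = frontier (Oct.toSlice J ⁻¹' U)
  winding_inside : ∀ z : ℂ, Oct.toSlice J z ∈ U →
    (∑ i, ∫ t in (0 : ℝ)..1, deriv (γ i) t / (γ i t - z)) = 2 * (Real.pi : ℂ) * Complex.I
  winding_outside : ∀ z : ℂ, Oct.toSlice J z ∉ closure U →
    (∑ i, ∫ t in (0 : ℝ)..1, deriv (γ i) t / (γ i t - z)) = 0

/-- The integral `∫_{∂(U ∩ ℂ_J)} Φ(s, ds)` along a slice contour: the integrand gets the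
point of the curve and its derivative (both in the coordinates of the slice). -/
def contourSum {J : Oct} {U : Set Oct} (Γ : SliceContour J U) {E : Type*}
    [NormedAddCommGroup E] [NormedSpace ℝ E] (Φ : ℂ → ℂ → E) : E :=
  ∑ i, ∫ t in (0 : ℝ)..1, Φ (Γ.γ i t) (deriv (Γ.γ i) t)

/-- An axially symmetric slice domain (s-domain) in `𝕆`. -/
structure IsAdmissibleDomain (U : Set Oct) : Prop where
  isOpen : IsOpen U
  isConnected : IsConnected U
  real_nonempty : (U ∩ {s : Oct | ∃ r : ℝ, s = r • (1 : Oct)}).Nonempty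
  axially : ∀ (z : ℂ), ∀ I ∈ unitSphere, ∀ J ∈ unitSphere,
    Oct.toSlice I z ∈ U → Oct.toSlice J z ∈ U
  slice_conn : ∀ J ∈ unitSphere, IsConnected (Oct.toSlice J ⁻¹' U)

section Adm

variable {V : Type*} [NormedAddCommGroup V] [NormedSpace ℝ V] [OctBimodule V]

/-- A `T`-left-admissible domain: an axially symmetric s-domain containing the pull-back
spectrum `σ*(T)`.  (The regularity of its slice boundaries is witnessed by the slice
contours used in the integrals.) -/
def LeftAdmissible (T : V →L[ℝ] V) (U : Set Oct) : Prop :=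
  IsAdmissibleDomain U ∧ pbSpec T ⊆ U

/-- A `T`-right-admissible domain: an axially symmetric s-domain containing the push-forward
spectrum `σ_*(T)`. -/
def RightAdmissible (T : V →L[ℝ] V) (U : Set Oct) : Prop :=
  IsAdmissibleDomain U ∧ pfSpec T ⊆ U

end Adm

/-- The axially symmetric set `Ω_D ⊆ 𝕆` induced by a conjugation-invariant set `D ⊆ ℂ`. -/
def OmegaD (D : Set ℂ) : Set Oct := ⋃ J ∈ unitSphere, Oct.toSlice J '' D

/-- `F` is the stem of a slice preserving slice regular function on `Ω_D`: it is holomorphic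
on the open conjugation-invariant set `D` and intertwines complex conjugation. -/
structure IsStem (D : Set ℂ) (F : ℂ → ℂ) : Prop where
  isOpen : IsOpen D
  conj_mem : ∀ z ∈ D, (starRingEnd ℂ) z ∈ D
  holo : DifferentiableOn ℂ F D
  conj_comm : ∀ z ∈ D, F ((starRingEnd ℂ) z) = (starRingEnd ℂ) (F z)

section FC

variable {V : Type*} [NormedAddCommGroup V] [NormedSpace ℝ V] [OctBimodule V]

/-- The slice integral `(1/2π) ∫_{∂(U∩ℂ_J)} (R_s - T)^{⊚-} ⊙ (ds_J f(s))` defining the left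
slice regular functional calculus of a slice preserving function with stem `F`. -/
def leftFC (T : V →L[ℝ] V) (J : Oct) {U : Set Oct} (Γ : SliceContour J U)
    (F : ℂ → ℂ) : V →L[ℝ] V :=
  (2 * Real.pi)⁻¹ • contourSum Γ fun z dz =>
    odotR (rinvR ((rmo (Oct.toSlice J z) : V →L[ℝ] V) - T))
      ((-(Oct.toSlice J dz) * J) * Oct.toSlice J (F z))

/-- The slice integral `(1/2π) ∫_{∂(U∩ℂ_J)} (f(s) ds_J) ⊙ (R_s - T)^{-⊚}` defining the right
slice regular functional calculus of a slice preserving function with stem `F`. -/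
def rightFC (T : V →L[ℝ] V) (J : Oct) {U : Set Oct} (Γ : SliceContour J U)
    (F : ℂ → ℂ) : V →L[ℝ] V :=
  (2 * Real.pi)⁻¹ • contourSum Γ fun z dz =>
    odotL (Oct.toSlice J (F z) * (-(Oct.toSlice J dz) * J))
      (rinvL ((rmo (Oct.toSlice J z) : V →L[ℝ] V) - T))

end FC

/-- The family of stems of the components, relative to `J = ∑ c_i e_i`, of a function of the
form `f₀ + f₁ • J` with `f₀, f₁` slice preserving with stems `F₀, F₁`. -/
def stemFamily (c : Fin 8 → ℝ) (F₀ F₁ : ℂ → ℂ) : Fin 8 → ℂ → ℂ :=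
  fun i z => if i = 0 then F₀ z else (c i : ℂ) * F₁ z

namespace Oct

/-- Left multiplication by an octonion, as a real-linear map. -/
def lmulLin (q : Oct) : Oct →ₗ[ℝ] Oct where
  toFun x := q * x
  map_add' x y := by
    refine Oct.ext ?_ ?_
    · show q.a * (x.a + y.a) - star (x.b + y.b) * q.b =
        (q.a * x.a - star x.b * q.b) + (q.a * y.a - star y.b * q.b)
      rw [mul_add, star_add, add_mul]; abel
    · show (x.b + y.b) * q.a + q.b * star (x.a + y.a) =
        (x.b * q.a + q.b * star x.a) + (y.b * q.a + q.b * star y.a)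
      rw [add_mul, star_add, mul_add]; abel
  map_smul' r x := by
    refine Oct.ext ?_ ?_
    · show q.a * (r • x.a) - star (r • x.b) * q.b = r • (q.a * x.a - star x.b * q.b)
      rw [mul_smul_comm, Quaternion.star_smul, smul_mul_assoc, smul_sub]
    · show (r • x.b) * q.a + q.b * star (r • x.a) = r • (x.b * q.a + q.b * star x.a)
      rw [smul_mul_assoc, Quaternion.star_smul, mul_smul_comm, smul_add]

/-- Left multiplication `L_q : x ↦ q x` as a bounded real-linear operator on `𝕆`. -/
def Lq (q : Oct) : Oct →L[ℝ] Oct := (lmulLin q).toContinuousLinearMap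

/-- The two-sphere `[q] = {Re q + |Im q| J : J ∈ 𝕊}` associated with an octonion `q`. -/
def qSphere (q : Oct) : Set Oct :=
  {s | ∃ J ∈ unitSphere, s = Oct.re q • (1 : Oct) + ‖q - Oct.re q • (1 : Oct)‖ • J}

end Oct

namespace Oct

/-- The multiplication rules of a quaternionic triple of imaginary units with `a b = p`. -/
structure QuatLine (p a b : Oct) : Prop where
  pp : p * p = -1
  aa : a * a = -1
  bb : b * b = -1
  ab : a * b = p
  ba : b * a = -p
  pa : p * a = b
  ap : a * p = -b
  bp : b * p = a
  pb : p * b = -a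

lemma QuatLine.rotate {p a b : Oct} (h : QuatLine p a b) : QuatLine a b p :=
  ⟨h.aa, h.bb, h.pp, h.bp, h.pb, h.ab, h.ba, h.pa, h.ap⟩

/-- The three quaternionic lines through `p`, together with three further lines of the Fano plane
that fix their relative orientation. -/
structure LineTriple (p a b c d u v : Oct) : Prop where
  pab : QuatLine p a b
  pcd : QuatLine p c d
  puv : QuatLine p u v
  uad : QuatLine u a d
  bvd : QuatLine b v d
  cva : QuatLine c v a

lemma mul_a (x y : Oct) : (x * y).a = x.a * y.a - star y.b * x.b := rfl
lemma mul_b (x y : Oct) : (x * y).b = y.b * x.a + x.b * star y.a := rfl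

/-- The octonion with the given coordinates in the standard basis. -/
def ofCoords (x₀ x₁ x₂ x₃ x₄ x₅ x₆ x₇ : ℝ) : Oct := ⟨⟨x₀, x₁, x₂, x₃⟩, ⟨x₄, x₅, x₆, x₇⟩⟩

lemma mul_eq_ofCoords (x y : Oct) : x * y = ofCoords
      (x.a.re * y.a.re - x.a.imI * y.a.imI - x.a.imJ * y.a.imJ - x.a.imK * y.a.imK -
        x.b.re * y.b.re - x.b.imI * y.b.imI - x.b.imJ * y.b.imJ - x.b.imK * y.b.imK)
      (x.a.re * y.a.imI + x.a.imI * y.a.re + x.a.imJ * y.a.imK - x.a.imK * y.a.imJ +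
        x.b.re * y.b.imI - x.b.imI * y.b.re - x.b.imJ * y.b.imK + x.b.imK * y.b.imJ)
      (x.a.re * y.a.imJ - x.a.imI * y.a.imK + x.a.imJ * y.a.re + x.a.imK * y.a.imI +
        x.b.re * y.b.imJ + x.b.imI * y.b.imK - x.b.imJ * y.b.re - x.b.imK * y.b.imI)
      (x.a.re * y.a.imK + x.a.imI * y.a.imJ - x.a.imJ * y.a.imI + x.a.imK * y.a.re +
        x.b.re * y.b.imK - x.b.imI * y.b.imJ + x.b.imJ * y.b.imI - x.b.imK * y.b.re)
      (x.a.re * y.b.re - x.a.imI * y.b.imI - x.a.imJ * y.b.imJ - x.a.imK * y.b.imK +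
        x.b.re * y.a.re + x.b.imI * y.a.imI + x.b.imJ * y.a.imJ + x.b.imK * y.a.imK)
      (x.a.re * y.b.imI + x.a.imI * y.b.re - x.a.imJ * y.b.imK + x.a.imK * y.b.imJ -
        x.b.re * y.a.imI + x.b.imI * y.a.re - x.b.imJ * y.a.imK + x.b.imK * y.a.imJ)
      (x.a.re * y.b.imJ + x.a.imI * y.b.imK + x.a.imJ * y.b.re - x.a.imK * y.b.imI -
        x.b.re * y.a.imJ + x.b.imI * y.a.imK + x.b.imJ * y.a.re - x.b.imK * y.a.imI)
      (x.a.re * y.b.imK - x.a.imI * y.b.imJ + x.a.imJ * y.b.imI + x.a.imK * y.b.re -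
        x.b.re * y.a.imK - x.b.imI * y.a.imJ + x.b.imJ * y.a.imI + x.b.imK * y.a.re) := by
  refine Oct.ext (Quaternion.ext _ _ ?_ ?_ ?_ ?_) (Quaternion.ext _ _ ?_ ?_ ?_ ?_) <;>
  · simp only [mul_a, mul_b, Quaternion.re_sub, Quaternion.imI_sub, Quaternion.imJ_sub,
      Quaternion.imK_sub, Quaternion.re_add, Quaternion.imI_add, Quaternion.imJ_add,
      Quaternion.imK_add, Quaternion.re_mul, Quaternion.imI_mul, Quaternion.imJ_mul,
      Quaternion.imK_mul, Quaternion.re_star, Quaternion.imI_star, Quaternion.imJ_star,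
      Quaternion.imK_star, ofCoords]
    ring

lemma ofCoords_mul (x₀ x₁ x₂ x₃ x₄ x₅ x₆ x₇ y₀ y₁ y₂ y₃ y₄ y₅ y₆ y₇ : ℝ) :
    ofCoords x₀ x₁ x₂ x₃ x₄ x₅ x₆ x₇ * ofCoords y₀ y₁ y₂ y₃ y₄ y₅ y₆ y₇ = ofCoords
      (x₀ * y₀ - x₁ * y₁ - x₂ * y₂ - x₃ * y₃ - x₄ * y₄ - x₅ * y₅ - x₆ * y₆ - x₇ * y₇)
      (x₀ * y₁ + x₁ * y₀ + x₂ * y₃ - x₃ * y₂ + x₄ * y₅ - x₅ * y₄ - x₆ * y₇ + x₇ * y₆)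
      (x₀ * y₂ - x₁ * y₃ + x₂ * y₀ + x₃ * y₁ + x₄ * y₆ + x₅ * y₇ - x₆ * y₄ - x₇ * y₅)
      (x₀ * y₃ + x₁ * y₂ - x₂ * y₁ + x₃ * y₀ + x₄ * y₇ - x₅ * y₆ + x₆ * y₅ - x₇ * y₄)
      (x₀ * y₄ - x₁ * y₅ - x₂ * y₆ - x₃ * y₇ + x₄ * y₀ + x₅ * y₁ + x₆ * y₂ + x₇ * y₃)
      (x₀ * y₅ + x₁ * y₄ - x₂ * y₇ + x₃ * y₆ - x₄ * y₁ + x₅ * y₀ - x₆ * y₃ + x₇ * y₂)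
      (x₀ * y₆ + x₁ * y₇ + x₂ * y₄ - x₃ * y₅ - x₄ * y₂ + x₅ * y₃ + x₆ * y₀ - x₇ * y₁)
      (x₀ * y₇ - x₁ * y₆ + x₂ * y₅ + x₃ * y₄ - x₄ * y₃ - x₅ * y₂ + x₆ * y₁ + x₇ * y₀) :=
  mul_eq_ofCoords _ _

lemma ofCoords_neg (x₀ x₁ x₂ x₃ x₄ x₅ x₆ x₇ : ℝ) :
    -ofCoords x₀ x₁ x₂ x₃ x₄ x₅ x₆ x₇ = ofCoords (-x₀) (-x₁) (-x₂) (-x₃) (-x₄) (-x₅) (-x₆) (-x₇) :=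
  rfl
lemma one_eq_ofCoords : (1 : Oct) = ofCoords 1 0 0 0 0 0 0 0 := rfl


lemma eNat_eq_ofCoords :
    eNat 1 = ofCoords 0 1 0 0 0 0 0 0 ∧ eNat 2 = ofCoords 0 0 1 0 0 0 0 0 ∧
      eNat 3 = ofCoords 0 0 0 1 0 0 0 0 ∧ eNat 4 = ofCoords 0 0 0 0 1 0 0 0 ∧
      eNat 5 = ofCoords 0 0 0 0 0 1 0 0 ∧ eNat 6 = ofCoords 0 0 0 0 0 0 1 0 ∧
      eNat 7 = ofCoords 0 0 0 0 0 0 0 1 :=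
  ⟨rfl, rfl, rfl, rfl, rfl, rfl, rfl⟩

lemma eq_sum_coords (p : Oct) : p = p.a.re • (1 : Oct) + p.a.imI • eNat 1 + p.a.imJ • eNat 2 +
    p.a.imK • eNat 3 + p.b.re • eNat 4 + p.b.imI • eNat 5 + p.b.imJ • eNat 6 +
    p.b.imK • eNat 7 := by
  have hs : ∀ r x₀ x₁ x₂ x₃ x₄ x₅ x₆ x₇ : ℝ, r • ofCoords x₀ x₁ x₂ x₃ x₄ x₅ x₆ x₇ =
    ofCoords (r * x₀) (r * x₁) (r * x₂) (r * x₃) (r * x₄) (r * x₅) (r * x₆) (r * x₇) :=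
    fun _ _ _ _ _ _ _ _ _ => rfl
  have ha : ∀ x₀ x₁ x₂ x₃ x₄ x₅ x₆ x₇ y₀ y₁ y₂ y₃ y₄ y₅ y₆ y₇ : ℝ,
    ofCoords x₀ x₁ x₂ x₃ x₄ x₅ x₆ x₇ + ofCoords y₀ y₁ y₂ y₃ y₄ y₅ y₆ y₇ =
    ofCoords (x₀ + y₀) (x₁ + y₁) (x₂ + y₂) (x₃ + y₃) (x₄ + y₄) (x₅ + y₅) (x₆ + y₆) (x₇ + y₇) :=
    fun _ _ _ _ _ _ _ _ _ _ _ _ _ _ _ _ => rfl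
  simp only [eNat_eq_ofCoords, one_eq_ofCoords, hs, ha, mul_one, mul_zero, add_zero, zero_add]
  rfl

lemma quatLine_123 : QuatLine (eNat 1) (eNat 2) (eNat 3) := by
  constructor <;> simp [eNat_eq_ofCoords, ofCoords_mul, ofCoords_neg, one_eq_ofCoords]

lemma quatLine_145 : QuatLine (eNat 1) (eNat 4) (eNat 5) := by
  constructor <;> simp [eNat_eq_ofCoords, ofCoords_mul, ofCoords_neg, one_eq_ofCoords]

lemma quatLine_176 : QuatLine (eNat 1) (eNat 7) (eNat 6) := by
  constructor <;> simp [eNat_eq_ofCoords, ofCoords_mul, ofCoords_neg, one_eq_ofCoords]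

lemma quatLine_246 : QuatLine (eNat 2) (eNat 4) (eNat 6) := by
  constructor <;> simp [eNat_eq_ofCoords, ofCoords_mul, ofCoords_neg, one_eq_ofCoords]

lemma quatLine_257 : QuatLine (eNat 2) (eNat 5) (eNat 7) := by
  constructor <;> simp [eNat_eq_ofCoords, ofCoords_mul, ofCoords_neg, one_eq_ofCoords]

lemma quatLine_347 : QuatLine (eNat 3) (eNat 4) (eNat 7) := by
  constructor <;> simp [eNat_eq_ofCoords, ofCoords_mul, ofCoords_neg, one_eq_ofCoords]

lemma quatLine_365 : QuatLine (eNat 3) (eNat 6) (eNat 5) := by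
  constructor <;> simp [eNat_eq_ofCoords, ofCoords_mul, ofCoords_neg, one_eq_ofCoords]

lemma lineTriple_1 :
    LineTriple (eNat 1) (eNat 2) (eNat 3) (eNat 4) (eNat 5) (eNat 7) (eNat 6) :=
  ⟨quatLine_123, quatLine_145, quatLine_176,
    quatLine_257.rotate.rotate, quatLine_365, quatLine_246.rotate⟩

lemma lineTriple_2 :
    LineTriple (eNat 2) (eNat 3) (eNat 1) (eNat 4) (eNat 6) (eNat 5) (eNat 7) :=
  ⟨quatLine_123.rotate, quatLine_246, quatLine_257,
    quatLine_365.rotate.rotate, quatLine_176, quatLine_347.rotate⟩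

lemma lineTriple_3 :
    LineTriple (eNat 3) (eNat 1) (eNat 2) (eNat 4) (eNat 7) (eNat 6) (eNat 5) :=
  ⟨quatLine_123.rotate.rotate, quatLine_347, quatLine_365,
    quatLine_176.rotate.rotate, quatLine_257, quatLine_145.rotate⟩

lemma lineTriple_4 :
    LineTriple (eNat 4) (eNat 5) (eNat 1) (eNat 7) (eNat 3) (eNat 6) (eNat 2) :=
  ⟨quatLine_145.rotate, quatLine_347.rotate, quatLine_246.rotate,
    quatLine_365.rotate, quatLine_123, quatLine_257.rotate.rotate⟩

lemma lineTriple_5 :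
    LineTriple (eNat 5) (eNat 1) (eNat 4) (eNat 7) (eNat 2) (eNat 3) (eNat 6) :=
  ⟨quatLine_145.rotate.rotate, quatLine_257.rotate, quatLine_365.rotate.rotate,
    quatLine_123.rotate.rotate, quatLine_246.rotate, quatLine_176.rotate⟩

lemma lineTriple_6 :
    LineTriple (eNat 6) (eNat 1) (eNat 7) (eNat 2) (eNat 4) (eNat 5) (eNat 3) :=
  ⟨quatLine_176.rotate.rotate, quatLine_246.rotate.rotate, quatLine_365.rotate,
    quatLine_145.rotate.rotate, quatLine_347.rotate.rotate, quatLine_123.rotate⟩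

lemma lineTriple_7 :
    LineTriple (eNat 7) (eNat 2) (eNat 5) (eNat 3) (eNat 4) (eNat 6) (eNat 1) :=
  ⟨quatLine_257.rotate.rotate, quatLine_347.rotate.rotate, quatLine_176.rotate,
    quatLine_246.rotate.rotate, quatLine_145.rotate.rotate, quatLine_123.rotate.rotate⟩

end Oct

section
variable {V : Type*} [NormedAddCommGroup V] [NormedSpace ℝ V] [OctBimodule V]

lemma lmo_mul_sub (p q : Oct) :
    (lmo (p * q) : V →L[ℝ] V) - lmo p * lmo q = rmo p * lmo q - lmo q * rmo p :=
  ContinuousLinearMap.ext fun x => OctBimodule.assoc_cyc₁ p q x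

lemma lmo_mul_sub' (p q : Oct) :
    (lmo (p * q) : V →L[ℝ] V) - lmo p * lmo q = rmo q * rmo p - rmo (p * q) :=
  ContinuousLinearMap.ext fun x => OctBimodule.assoc_cyc₂ p q x

lemma lmo_mul_sub_swap (p q : Oct) :
    (lmo (p * q) : V →L[ℝ] V) - lmo p * lmo q = -(lmo (q * p) - lmo q * lmo p) :=
  ContinuousLinearMap.ext fun x => OctBimodule.assoc_alt p q x

lemma lmo_mul_sub_self (p : Oct) : (lmo (p * p) : V →L[ℝ] V) - lmo p * lmo p = 0 := by
  have h := eq_neg_iff_add_eq_zero.1 (lmo_mul_sub_swap (V := V) p p)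
  rw [← two_smul ℝ] at h
  exact (smul_eq_zero.1 h).resolve_left two_ne_zero

lemma lmo_neg (p : Oct) : (lmo (-p) : V →L[ℝ] V) = -lmo p := map_neg OctBimodule.lm p
lemma rmo_neg (p : Oct) : (rmo (-p) : V →L[ℝ] V) = -rmo p := map_neg OctBimodule.rm p
lemma lmo_one : (lmo 1 : V →L[ℝ] V) = 1 := ContinuousLinearMap.ext OctBimodule.lm_one
lemma rmo_one : (rmo 1 : V →L[ℝ] V) = 1 := ContinuousLinearMap.ext OctBimodule.rm_one

lemma lmo_mul_self {p : Oct} (h : p * p = -1) : (lmo p * lmo p : V →L[ℝ] V) = -1 := by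
  have h1 := lmo_mul_sub_self (V := V) p
  rw [h, lmo_neg, lmo_one, sub_eq_zero] at h1
  exact h1.symm

lemma rmo_mul_lmo_self (p : Oct) : (rmo p * lmo p : V →L[ℝ] V) = lmo p * rmo p := by
  have h1 := lmo_mul_sub (V := V) p p
  rwa [lmo_mul_sub_self p, eq_comm, sub_eq_zero] at h1

lemma rmo_mul_self {p : Oct} (h : p * p = -1) : (rmo p * rmo p : V →L[ℝ] V) = -1 := by
  have h1 := lmo_mul_sub' (V := V) p p
  rwa [lmo_mul_sub_self p, eq_comm, sub_eq_zero, h, rmo_neg,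
    rmo_one] at h1

/-- The operator `x ↦ p x - x p`. -/
def commOp (p : Oct) : V →L[ℝ] V := lmo p - rmo p

lemma sandwich_self {p : Oct} (h : p * p = -1) :
    (rmo p * lmo p * commOp p : V →L[ℝ] V) = commOp p := by
  have h1 := lmo_mul_self (V := V) h
  have h2 := rmo_mul_self (V := V) h
  have h3 := rmo_mul_lmo_self (V := V) p
  rw [commOp]
  linear_combination (norm := noncomm_ring) rmo p * h1 - h3 * rmo p - lmo p * h2

lemma sandwich_line {p a b : Oct} (h : QuatLine p a b) :
    (rmo a * lmo a * commOp p + rmo b * lmo b * commOp p : V →L[ℝ] V) =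
      2 * (lmo p - lmo a * lmo b) := by
  have h1 := lmo_mul_sub (V := V) p b
  have h2 := lmo_mul_sub' (V := V) p b
  have h3 := lmo_mul_self (V := V) h.bb
  have h4 := rmo_mul_lmo_self (V := V) a
  have h5 := lmo_mul_sub_swap (V := V) p a
  have h6 := rmo_mul_self (V := V) h.aa
  have h7 := lmo_mul_sub' (V := V) p a
  have h8 := lmo_mul_self (V := V) h.aa
  have h9 := lmo_mul_sub' (V := V) b p
  have h10 := lmo_mul_sub' (V := V) a b
  have h11 := rmo_mul_lmo_self (V := V) b
  have h12 := lmo_mul_sub (V := V) b p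
  have h13 := lmo_mul_sub_swap (V := V) p b
  simp only [h.ab, h.pa, h.ap, h.pb, h.bp, lmo_neg, rmo_neg] at h1 h2 h5 h7 h9 h10 h12 h13
  rw [commOp]
  linear_combination (norm := noncomm_ring) -rmo b * h1 + h2 * lmo b + lmo p * h3 -
    (h4 + h8) * rmo p - rmo a * h5 + rmo a * h7 + h6 * rmo p + h8 * rmo p + lmo a * h7 - h8 * lmo p -
    lmo a * h5 - rmo b * h9 + h2 * rmo b - h10 - lmo p * (h11 + h3) + h12 * lmo b - h13 * lmo b

lemma sum_lines {p a b c d u v : Oct} (h : LineTriple p a b c d u v) :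
    (lmo p + 2 * rmo p : V →L[ℝ] V) = lmo a * lmo b + lmo c * lmo d + lmo u * lmo v := by
  have h1 := lmo_mul_sub_swap (V := V) v u
  have h2 := lmo_mul_sub (V := V) v d
  have h3 := lmo_mul_sub' (V := V) v a
  have h4 := lmo_mul_sub_swap (V := V) c d
  have h5 := lmo_mul_sub (V := V) a d
  have h6 := lmo_mul_sub_swap (V := V) a b
  have h7 := lmo_mul_sub' (V := V) b a
  have h8 := lmo_mul_sub (V := V) c d
  have h9 := lmo_mul_sub' (V := V) v u
  have h10 := lmo_mul_sub' (V := V) v d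
  have h11 := lmo_mul_sub' (V := V) d a
  have h12 := lmo_mul_sub_swap (V := V) a d
  have h13 := lmo_mul_sub_swap (V := V) d v
  simp only [h.pab.ab, h.pab.ba, h.pcd.ab, h.pcd.ba, h.puv.ab, h.puv.ba, h.uad.ab, h.uad.ba,
    h.bvd.ab, h.bvd.ba, h.cva.ab, lmo_neg, rmo_neg] at h1 h2 h3 h4 h5 h6 h7 h8 h9 h10 h11 h12 h13
  linear_combination (norm := noncomm_ring) h1 + rmo a * h2 - h3 * lmo d + h4 + h5 * rmo v +
    lmo d * h3 + h6 - h7 - h8 - h9 - rmo a * h10 + h11 * rmo v - h12 * rmo v - h13 * lmo a +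
    lmo v * h12


lemma sum_sandwich {p a b c d u v : Oct} (h : LineTriple p a b c d u v) :
    (rmo p * lmo p * commOp p + (rmo a * lmo a * commOp p + rmo b * lmo b * commOp p) +
      (rmo c * lmo c * commOp p + rmo d * lmo d * commOp p) +
      (rmo u * lmo u * commOp p + rmo v * lmo v * commOp p) : V →L[ℝ] V) = 5 * commOp p := by
  rw [sandwich_self h.pab.pp, sandwich_line h.pab, sandwich_line h.pcd, sandwich_line h.puv]
  rw [commOp]
  linear_combination (norm := noncomm_ring) 2 * sum_lines (V := V) h


variable (V) in
lemma reO_eq : reO V = (5 / 12 : ℝ) • 1 - (1 / 12 : ℝ) •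
    (rmo (eNat 1) * lmo (eNat 1) + rmo (eNat 2) * lmo (eNat 2) + rmo (eNat 3) * lmo (eNat 3) +
      rmo (eNat 4) * lmo (eNat 4) + rmo (eNat 5) * lmo (eNat 5) + rmo (eNat 6) * lmo (eNat 6) +
      rmo (eNat 7) * lmo (eNat 7)) := by
  rw [reO, Fin.sum_univ_seven]
  rfl

lemma reO_mul_commOp_of_lineTriple {p a b c d u v : Oct} (h : LineTriple p a b c d u v)
    (hr : reO V = (5 / 12 : ℝ) • 1 - (1 / 12 : ℝ) •
      (rmo p * lmo p + (rmo a * lmo a + rmo b * lmo b) + (rmo c * lmo c + rmo d * lmo d) +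
        (rmo u * lmo u + rmo v * lmo v))) :
    reO V * commOp p = 0 := by
  have h1 := sum_sandwich (V := V) h
  simp only [← add_mul] at h1
  rw [hr, sub_mul, smul_mul_assoc, smul_mul_assoc, h1, one_mul]
  ext x
  simp only [sub_apply, smul_apply]
  change (5 / 12 : ℝ) • commOp p x - (1 / 12 : ℝ) • (5 • commOp p x) = 0
  module

lemma reO_mul_commOp_eNat :
    (reO V * commOp (eNat 1) = 0 ∧ reO V * commOp (eNat 2) = 0 ∧ reO V * commOp (eNat 3) = 0 ∧
      reO V * commOp (eNat 4) = 0 ∧ reO V * commOp (eNat 5) = 0 ∧ reO V * commOp (eNat 6) = 0 ∧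
      reO V * commOp (eNat 7) = 0) := by
  refine ⟨reO_mul_commOp_of_lineTriple lineTriple_1 ?_,
    reO_mul_commOp_of_lineTriple lineTriple_2 ?_, reO_mul_commOp_of_lineTriple lineTriple_3 ?_,
    reO_mul_commOp_of_lineTriple lineTriple_4 ?_, reO_mul_commOp_of_lineTriple lineTriple_5 ?_,
    reO_mul_commOp_of_lineTriple lineTriple_6 ?_, reO_mul_commOp_of_lineTriple lineTriple_7 ?_⟩ <;>
  · rw [reO_eq]
    congr 2
    abel

lemma reO_mul_commOp (p : Oct) : reO V * commOp p = 0 := by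
  obtain ⟨h1, h2, h3, h4, h5, h6, h7⟩ := reO_mul_commOp_eNat (V := V)
  have hc : ∀ q : Oct, (commOp q : V →L[ℝ] V) =
      (OctBimodule.lm - OctBimodule.rm : Oct →ₗ[ℝ] V →L[ℝ] V) q := fun _ => rfl
  have h0 : (commOp 1 : V →L[ℝ] V) = 0 := by rw [commOp, lmo_one, rmo_one, sub_self]
  rw [hc] at h0 h1 h2 h3 h4 h5 h6 h7 ⊢
  rw [eq_sum_coords p]
  simp only [map_add, map_smul, h0, mul_add, mul_smul_comm, h1, h2, h3, h4, h5, h6, h7,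
    smul_zero, add_zero, mul_zero]

/-- The real part of a bimodule element does not see the side of a scalar multiplication. -/
lemma reO_lmo (p : Oct) (x : V) : reO V (lmo p x) = reO V (rmo p x) := by
  have h := congrArg (fun S : V →L[ℝ] V => S x) (reO_mul_commOp (V := V) p)
  exact sub_eq_zero.1 ((map_sub (reO V) _ _).symm.trans h)

end

namespace Oct

lemma ofCoords_inj {x₀ x₁ x₂ x₃ x₄ x₅ x₆ x₇ y₀ y₁ y₂ y₃ y₄ y₅ y₆ y₇ : ℝ}
    (h : ofCoords x₀ x₁ x₂ x₃ x₄ x₅ x₆ x₇ = ofCoords y₀ y₁ y₂ y₃ y₄ y₅ y₆ y₇) :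
    x₀ = y₀ ∧ x₁ = y₁ ∧ x₂ = y₂ ∧ x₃ = y₃ ∧ x₄ = y₄ ∧ x₅ = y₅ ∧ x₆ = y₆ ∧ x₇ = y₇ :=
  ⟨congrArg (fun x => x.a.re) h, congrArg (fun x => x.a.imI) h, congrArg (fun x => x.a.imJ) h,
    congrArg (fun x => x.a.imK) h, congrArg (fun x => x.b.re) h, congrArg (fun x => x.b.imI) h,
    congrArg (fun x => x.b.imJ) h, congrArg (fun x => x.b.imK) h⟩

lemma norm_sq_eq (x : Oct) : ‖x‖ ^ 2 = x.a.re ^ 2 + x.a.imI ^ 2 + x.a.imJ ^ 2 + x.a.imK ^ 2 +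
    (x.b.re ^ 2 + x.b.imI ^ 2 + x.b.imJ ^ 2 + x.b.imK ^ 2) := by
  rw [← Quaternion.normSq_def', ← Quaternion.normSq_def', Quaternion.normSq_eq_norm_mul_self,
    Quaternion.normSq_eq_norm_mul_self, ← sq, ← sq]
  exact WithLp.prod_norm_sq_eq_of_L2 (toLp x)

lemma add_mul' (x y q : Oct) : (x + y) * q = x * q + y * q := by
  refine Oct.ext ?_ ?_
  · change (x.a + y.a) * q.a - star q.b * (x.b + y.b) =
      (x.a * q.a - star q.b * x.b) + (y.a * q.a - star q.b * y.b)
    rw [add_mul, mul_add]; abel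
  · change q.b * (x.a + y.a) + (x.b + y.b) * star q.a =
      (q.b * x.a + x.b * star q.a) + (q.b * y.a + y.b * star q.a)
    rw [add_mul, mul_add]; abel

lemma smul_mul' (r : ℝ) (x q : Oct) : (r • x) * q = r • (x * q) := by
  refine Oct.ext ?_ ?_
  · change (r • x.a) * q.a - star q.b * (r • x.b) = r • (x.a * q.a - star q.b * x.b)
    rw [smul_mul_assoc, mul_smul_comm, smul_sub]
  · change q.b * (r • x.a) + (r • x.b) * star q.a = r • (q.b * x.a + x.b * star q.a)
    rw [smul_mul_assoc, mul_smul_comm, smul_add]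

lemma mul_add' (q x y : Oct) : q * (x + y) = q * x + q * y := map_add (lmulLin q) x y

lemma mul_smul' (r : ℝ) (q x : Oct) : q * (r • x) = r • (q * x) := map_smul (lmulLin q) r x

lemma one_mul' (q : Oct) : 1 * q = q :=
  Oct.ext (by rw [mul_a]; change 1 * q.a - star q.b * 0 = _; simp)
    (by rw [mul_b]; change q.b * 1 + 0 * star q.a = _; simp)

lemma mul_one' (q : Oct) : q * 1 = q :=
  Oct.ext (by rw [mul_a]; change q.a * 1 - star 0 * q.b = _; simp)
    (by rw [mul_b]; change 0 * q.a + q.b * star 1 = _; simp)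

variable {J : Oct}

lemma re_eq_zero_of_mem_unitSphere (hJ : J ∈ unitSphere) : J.a.re = 0 := by
  have h : J * J = -1 := hJ
  rw [mul_eq_ofCoords, one_eq_ofCoords, ofCoords_neg] at h
  obtain ⟨h0, h1, h2, h3, h4, h5, h6, h7⟩ := ofCoords_inj h
  by_contra hr
  have k1 : J.a.imI = 0 := mul_left_cancel₀ hr (by linarith)
  have k2 : J.a.imJ = 0 := mul_left_cancel₀ hr (by linarith)
  have k3 : J.a.imK = 0 := mul_left_cancel₀ hr (by linarith)
  have k4 : J.b.re = 0 := mul_left_cancel₀ hr (by linarith)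
  have k5 : J.b.imI = 0 := mul_left_cancel₀ hr (by linarith)
  have k6 : J.b.imJ = 0 := mul_left_cancel₀ hr (by linarith)
  have k7 : J.b.imK = 0 := mul_left_cancel₀ hr (by linarith)
  rw [k1, k2, k3, k4, k5, k6, k7] at h0
  nlinarith [sq_nonneg J.a.re]

lemma norm_sq_of_mem_unitSphere (hJ : J ∈ unitSphere) : ‖J‖ ^ 2 = 1 := by
  have hr := re_eq_zero_of_mem_unitSphere hJ
  have h : J * J = -1 := hJ
  rw [mul_eq_ofCoords, one_eq_ofCoords, ofCoords_neg] at h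
  have h0 := (ofCoords_inj h).1
  rw [norm_sq_eq]
  rw [hr] at h0 ⊢
  linarith

lemma conj_toSlice (hJ : J ∈ unitSphere) (z : ℂ) :
    conj (toSlice J z) = toSlice J (starRingEnd ℂ z) := by
  have ha : star J.a = -J.a := Quaternion.star_eq_neg.2 (re_eq_zero_of_mem_unitSphere hJ)
  refine Oct.ext ?_ ?_
  · change star (z.re • (1 : Quaternion ℝ) + z.im • J.a) = z.re • 1 + (-z.im) • J.a
    rw [star_add, Quaternion.star_smul, Quaternion.star_smul, ha, star_one, smul_neg, neg_smul]
  · change -(z.re • (0 : Quaternion ℝ) + z.im • J.b) = z.re • 0 + (-z.im) • J.b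
    rw [smul_zero, zero_add, zero_add, neg_smul]

lemma norm_toSlice (hJ : J ∈ unitSphere) (z : ℂ) : ‖toSlice J z‖ = ‖z‖ := by
  rw [← sq_eq_sq₀ (norm_nonneg _) (norm_nonneg _), Complex.sq_norm, Complex.normSq_apply]
  have hr := re_eq_zero_of_mem_unitSphere hJ
  have h1 := norm_sq_of_mem_unitSphere hJ
  rw [norm_sq_eq] at h1 ⊢
  have h2 : toSlice J z = ofCoords (z.re * 1 + z.im * J.a.re) (z.re * 0 + z.im * J.a.imI)
      (z.re * 0 + z.im * J.a.imJ) (z.re * 0 + z.im * J.a.imK) (z.re * 0 + z.im * J.b.re)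
      (z.re * 0 + z.im * J.b.imI) (z.re * 0 + z.im * J.b.imJ) (z.re * 0 + z.im * J.b.imK) := rfl
  rw [h2]
  simp only [ofCoords]
  rw [hr] at h1 ⊢
  linear_combination z.im ^ 2 * h1

lemma toSlice_mul (hJ : J ∈ unitSphere) (z w : ℂ) :
    toSlice J (z * w) = toSlice J z * toSlice J w := by
  have h : J * J = -1 := hJ
  simp only [toSlice, add_mul', smul_mul', mul_add', mul_smul', one_mul', mul_one', h,
    Complex.mul_re, Complex.mul_im]
  module

lemma toSlice_one : toSlice J 1 = 1 := by simp [toSlice]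

lemma opow_toSlice (hJ : J ∈ unitSphere) (z : ℂ) (n : ℕ) :
    opow (toSlice J z) n = toSlice J (z ^ n) := by
  induction n with
  | zero => rw [pow_zero, toSlice_one, opow]
  | succ n ih => rw [opow, ih, ← toSlice_mul hJ, pow_succ']

lemma oinv_toSlice (hJ : J ∈ unitSphere) (z : ℂ) : oinv (toSlice J z) = toSlice J z⁻¹ := by
  rw [oinv, norm_toSlice hJ, conj_toSlice hJ, Complex.sq_norm]
  simp only [toSlice, Complex.inv_re, Complex.inv_im, Complex.conj_re, Complex.conj_im, div_eq_inv_mul]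
  module
end Oct

section SliceResolvent

variable {V : Type*} [NormedAddCommGroup V] [NormedSpace ℝ V]

/-- The terms of the series `∑ C(k + n, k) Tⁿ S(z)^(-(k + 1) - n)`, for a representation `S` of
`ℂ` by bounded operators. -/
def resolventTerm (S : ℂ →ₐ[ℝ] V →L[ℝ] V) (T : V →L[ℝ] V) (z : ℂ) (k n : ℕ) : V →L[ℝ] V :=
  ((k + n).choose k : ℝ) • (T ^ n * S (z⁻¹ ^ (k + 1 + n)))

variable {S : ℂ →ₐ[ℝ] V →L[ℝ] V} {T ρ : V →L[ℝ] V} {z : ℂ}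

lemma ContinuousLinearMap.norm_pow_le_pow_norm (T : V →L[ℝ] V) (n : ℕ) : ‖T ^ n‖ ≤ ‖T‖ ^ n := by
  rcases n.eq_zero_or_pos with rfl | hn
  · rw [pow_zero, pow_zero]
    exact ContinuousLinearMap.norm_id_le
  · exact norm_pow_le' T hn

lemma summable_resolventTerm [CompleteSpace V] (hS : ∀ w, ‖S w‖ ≤ ‖w‖) (hT : ‖T‖ < ‖z‖) (k : ℕ) :
    Summable (resolventTerm S T z k) := by
  have hz : 0 < ‖z‖ := (norm_nonneg T).trans_lt hT
  have hr : ‖‖T‖ / ‖z‖‖ < 1 := by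
    rw [Real.norm_of_nonneg (by positivity)]
    exact (div_lt_one hz).2 hT
  refine Summable.of_norm_bounded
    ((summable_choose_mul_geometric_of_norm_lt_one k hr).mul_left (‖z‖⁻¹ ^ (k + 1))) fun n => ?_
  rw [resolventTerm, norm_smul, Real.norm_of_nonneg (by positivity), add_comm n k]
  calc ((k + n).choose k : ℝ) * ‖T ^ n * S (z⁻¹ ^ (k + 1 + n))‖
      ≤ ((k + n).choose k : ℝ) * (‖T‖ ^ n * ‖z‖⁻¹ ^ (k + 1 + n)) := by
        gcongr
        refine (norm_mul_le _ _).trans ?_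
        gcongr
        · exact T.norm_pow_le_pow_norm n
        · simpa using hS (z⁻¹ ^ (k + 1 + n))
    _ = ‖z‖⁻¹ ^ (k + 1) * ((k + n).choose k * (‖T‖ / ‖z‖) ^ n) := by
        rw [div_eq_mul_inv, mul_pow, pow_add]
        ring

lemma tsum_sub_eq_add_tsum {E : Type*} [NormedAddCommGroup E] {a b : ℕ → E} (ha : Summable a)
    (hb : Summable b) : ∑' n, a n - ∑' n, b n = a 0 + ∑' n, (a (n + 1) - b n) := by
  rw [((summable_nat_add_iff 1).2 ha).tsum_sub hb, ha.tsum_eq_zero_add]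
  abel

variable (hρ : ∀ (n : ℕ) (t : ℂ), ρ * T ^ n * S t = ρ * S t * T ^ n)
include hρ

lemma mul_resolventTerm (t : ℂ) (k n : ℕ) :
    ρ * S t * resolventTerm S T z k n =
      ((k + n).choose k : ℝ) • (ρ * T ^ n * S (t * z⁻¹ ^ (k + 1 + n))) := by
  rw [resolventTerm, mul_smul_comm, ← mul_assoc, ← hρ, map_mul, mul_assoc _ (S t)]

lemma mul_resolventTerm_mul_map (hz : z ≠ 0) (t : ℂ) (k n : ℕ) :
    ρ * S t * resolventTerm S T z k n * S z =
      ((k + n).choose k : ℝ) • (ρ * T ^ n * S (t * z⁻¹ ^ (k + n))) := by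
  rw [mul_resolventTerm hρ, smul_mul_assoc, mul_assoc _ (S _), ← map_mul, add_right_comm, pow_succ,
    mul_assoc t, mul_assoc _ z⁻¹, inv_mul_cancel₀ hz, mul_one]

lemma mul_resolventTerm_mul (t : ℂ) (k n : ℕ) :
    ρ * S t * resolventTerm S T z k n * T =
      ((k + n).choose k : ℝ) • (ρ * T ^ (n + 1) * S (t * z⁻¹ ^ (k + (n + 1)))) := by
  rw [mul_resolventTerm hρ, smul_mul_assoc, hρ, mul_assoc _ (T ^ n), ← pow_succ, ← hρ,
    add_right_comm, add_assoc]

variable [CompleteSpace V] (hS : ∀ w, ‖S w‖ ≤ ‖w‖) (hT : ‖T‖ < ‖z‖)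
include hS hT

lemma mul_tsum_resolventTerm_mul_sub (t : ℂ) (k : ℕ) :
    ρ * S t * (∑' n, resolventTerm S T z k n) * (S z - T) =
      ρ * S (t * z⁻¹ ^ k) + ∑' n, (((k + (n + 1)).choose k : ℝ) - ((k + n).choose k : ℝ)) •
        (ρ * T ^ (n + 1) * S (t * z⁻¹ ^ (k + (n + 1)))) := by
  have hz : z ≠ 0 := norm_pos_iff.1 ((norm_nonneg T).trans_lt hT)
  have h := (summable_resolventTerm hS hT k).mul_left (ρ * S t)
  rw [mul_sub, ← (summable_resolventTerm hS hT k).tsum_mul_left, ← h.tsum_mul_right,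
    ← h.tsum_mul_right, tsum_sub_eq_add_tsum (h.mul_right _) (h.mul_right _)]
  simp only [mul_resolventTerm_mul_map hρ hz, mul_resolventTerm_mul hρ, ← sub_smul]
  simp

lemma mul_tsum_resolventTerm_zero (t : ℂ) :
    ρ * S t * (∑' n, resolventTerm S T z 0 n) * (S z - T) = ρ * S t := by
  rw [mul_tsum_resolventTerm_mul_sub hρ hS hT]
  simp

lemma mul_tsum_resolventTerm_succ (t : ℂ) (k : ℕ) :
    ρ * S t * (∑' n, resolventTerm S T z (k + 1) n) * (S z - T) =
      ρ * S t * ∑' n, resolventTerm S T z k n := by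
  have h := (summable_resolventTerm hS hT k).mul_left (ρ * S t)
  rw [mul_tsum_resolventTerm_mul_sub hρ hS hT,
    ← (summable_resolventTerm hS hT k).tsum_mul_left, h.tsum_eq_zero_add]
  simp only [mul_resolventTerm hρ]
  congr 1
  · simp
  · refine tsum_congr fun n => ?_
    have hc : ((k + 1 + (n + 1)).choose (k + 1) : ℝ) =
        (k + (n + 1)).choose k + (k + 1 + n).choose (k + 1) := by
      rw [← Nat.cast_add, show k + 1 + (n + 1) = k + (n + 1) + 1 by ring, Nat.choose_succ_succ,
        show k + (n + 1) = k + 1 + n by ring]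
    rw [hc, add_sub_cancel_right]

lemma mul_tsum_resolventTerm_mul_pow (t : ℂ) (k : ℕ) :
    ρ * S t * (∑' n, resolventTerm S T z k n) * (S z - T) ^ (k + 1) = ρ * S t := by
  induction k with
  | zero => rw [zero_add, pow_one, mul_tsum_resolventTerm_zero hρ hS hT]
  | succ k ih => rw [pow_succ', ← mul_assoc, mul_tsum_resolventTerm_succ hρ hS hT, ih]

omit hρ in
lemma isUnit_map_sub : IsUnit (S z - T) := by
  have hz : 0 < ‖z‖ := (norm_nonneg T).trans_lt hT
  have h1 : S z * S z⁻¹ = 1 := by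
    rw [← map_mul, mul_inv_cancel₀ (norm_pos_iff.1 hz), map_one]
  have h2 : IsUnit (1 - S z⁻¹ * T) := isUnit_one_sub_of_norm_lt_one <| calc
    ‖S z⁻¹ * T‖ ≤ ‖z⁻¹‖ * ‖T‖ := (norm_mul_le _ _).trans (by gcongr; exact hS _)
    _ < 1 := by rw [norm_inv, inv_mul_lt_iff₀ hz, mul_one]; exact hT
  have h3 : S z - T = S z * (1 - S z⁻¹ * T) := by
    rw [mul_sub, mul_one, ← mul_assoc, h1, one_mul]
  rw [h3]
  exact ((isUnit_iff_ne_zero.2 (norm_pos_iff.1 hz)).map S).mul h2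

lemma mul_tsum_resolventTerm_eq (t : ℂ) (k : ℕ) :
    ρ * S t * ∑' n, resolventTerm S T z k n = ρ * S t * Ring.inverse (S z - T) ^ (k + 1) := by
  have h := Ring.mul_inverse_cancel _ (isUnit_map_sub hS hT)
  have hc : Commute (S z - T) (Ring.inverse (S z - T)) :=
    h.trans (Ring.inverse_mul_cancel _ (isUnit_map_sub hS hT)).symm
  nth_rewrite 2 [← mul_tsum_resolventTerm_mul_pow hρ hS hT t k]
  rw [mul_assoc _ ((S z - T) ^ (k + 1)), ← hc.mul_pow, h, one_pow, mul_one]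

lemma mul_inverse_pow_mul_map (t : ℂ) (k : ℕ) :
    ρ * Ring.inverse (S z - T) ^ (k + 1) * S t = ρ * S t * Ring.inverse (S z - T) ^ (k + 1) := by
  have hs := summable_resolventTerm hS hT k
  have h1 := mul_tsum_resolventTerm_eq hρ hS hT 1 k
  rw [map_one, mul_one] at h1
  rw [← h1, ← mul_tsum_resolventTerm_eq hρ hS hT, ← hs.tsum_mul_left, ← hs.tsum_mul_left,
    ← (hs.mul_left ρ).tsum_mul_right]
  refine tsum_congr fun n => ?_
  rw [mul_resolventTerm hρ, resolventTerm, mul_smul_comm, smul_mul_assoc, ← mul_assoc,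
    mul_assoc _ (S _), ← map_mul, mul_comm t]

end SliceResolvent

section SliceRep

variable {V : Type*} [NormedAddCommGroup V] [NormedSpace ℝ V] [OctBimodule V] {J : Oct}

/-- Right multiplication by elements of the slice `ℂ_J`, as a representation of `ℂ`. -/
def sliceRep (hJ : J ∈ unitSphere) : ℂ →ₐ[ℝ] V →L[ℝ] V :=
  Complex.liftAux (rmo J) (rmo_mul_self hJ)

lemma sliceRep_apply (hJ : J ∈ unitSphere) (z : ℂ) :
    (sliceRep hJ z : V →L[ℝ] V) = rmo (toSlice J z) := by
  have h : (rmo (toSlice J z) : V →L[ℝ] V) = z.re • rmo 1 + z.im • rmo J := by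
    change OctBimodule.rm (z.re • (1 : Oct) + z.im • J) = _
    rw [map_add, map_smul, map_smul]
    rfl
  rw [h, rmo_one, sliceRep, Complex.liftAux_apply, Algebra.algebraMap_eq_smul_one]

lemma norm_sliceRep_le (hJ : J ∈ unitSphere) (z : ℂ) : ‖(sliceRep hJ z : V →L[ℝ] V)‖ ≤ ‖z‖ := by
  refine ContinuousLinearMap.opNorm_le_bound _ (norm_nonneg z) fun x => ?_
  rw [sliceRep_apply, ← norm_toSlice hJ z]
  exact (OctBimodule.norm_rm _ x).le

lemma IsPowerAssoc.reO_mul_pow_mul_sliceRep {T : V →L[ℝ] V} (hT : IsPowerAssoc T)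
    (hJ : J ∈ unitSphere) (n : ℕ) (t : ℂ) :
    reO V * T ^ n * sliceRep hJ t = reO V * sliceRep hJ t * T ^ n := by
  ext x
  rw [sliceRep_apply]
  have h := hT n (toSlice J t) x
  exact (sub_eq_zero.1 ((map_sub (reO V) _ _).symm.trans h)).symm

lemma piJ_eq_of_reO_sliceRep_eq (hJ : J ∈ unitSphere) {x y : V}
    (h : ∀ t : ℂ, reO V (sliceRep hJ t x) = reO V (sliceRep hJ t y)) : piJ V J x = piJ V J y := by
  have h1 := h 1
  have h2 := h (-Complex.I)
  rw [map_one] at h1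
  have h3 : toSlice J (-Complex.I) = conj J := by
    have h4 : toSlice J Complex.I = J := by simp [toSlice]
    rw [← h4, conj_toSlice (h4.symm ▸ hJ), Complex.conj_I, h4]
  rw [sliceRep_apply, h3, ← reO_lmo, ← reO_lmo] at h2
  change reO V x + lmo J (reO V (lmo (conj J) x)) = reO V y + lmo J (reO V (lmo (conj J) y))
  rw [h2]
  exact congrArg (· + _) h1

lemma resolventTerm_sliceRep_apply (hJ : J ∈ unitSphere) (T : V →L[ℝ] V) (z : ℂ) (k n : ℕ) (v : V) :
    resolventTerm (sliceRep hJ) T z k n v = ((k + 1 + n - 1).choose (k + 1 - 1) : ℝ) •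
      (T ^ n) (rmo (opow (oinv (toSlice J z)) (k + 1 + n)) v) := by
  rw [resolventTerm, sliceRep_apply, oinv_toSlice hJ, opow_toSlice hJ, add_tsub_cancel_right,
    add_right_comm, add_tsub_cancel_right]
  rfl

end SliceRep

/-- Let `V` be a Banach `𝕆`-bimodule, `T` a power-associative bounded right
para-linear operator, `J ∈ 𝕊` and `s ∈ ℂ_J` with `|s| > ‖T‖`.  Then for every `m ≥ 1` and
every `v ∈ V`,
`π_J(∑_{n≥0} C(m+n−1, m−1) Tⁿ(v s^{−m−n})) = π_J((R_s − T)^{−m}(v))` (norm-convergent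
series).  In particular `(R_s − T)^{−1}` is `ℂ_J`-liftable power associative. -/
theorem statement_6 {V : Type*} [NormedAddCommGroup V] [NormedSpace ℝ V] [CompleteSpace V]
    [OctBimodule V] (T : V →L[ℝ] V) (hT : IsRightPara T) (hpa : IsPowerAssoc T)
    (J : Oct) (hJ : J ∈ unitSphere) (s : Oct) (hs : s ∈ sliceC J) (hnorm : ‖T‖ < ‖s‖) :
    IsUnit ((rmo s : V →L[ℝ] V) - T) ∧
    (∀ m : ℕ, 1 ≤ m → ∀ v : V,
      Summable (fun n : ℕ => ((m + n - 1).choose (m - 1) : ℝ) •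
        (T ^ n) (rmo (Oct.opow (Oct.oinv s) (m + n)) v)) ∧
      piJ V J (∑' n : ℕ, ((m + n - 1).choose (m - 1) : ℝ) •
          (T ^ n) (rmo (Oct.opow (Oct.oinv s) (m + n)) v)) =
        piJ V J ((Ring.inverse ((rmo s : V →L[ℝ] V) - T) ^ m) v)) ∧
    CJLiftPA J (Ring.inverse ((rmo s : V →L[ℝ] V) - T)) := by
  obtain ⟨x, y, rfl⟩ := hs
  obtain ⟨z, hz⟩ : ∃ z, toSlice J z = x • (1 : Oct) + y • J := ⟨⟨x, y⟩, rfl⟩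
  rw [← hz, norm_toSlice hJ] at hnorm
  rw [← hz, ← sliceRep_apply hJ]
  have hS := norm_sliceRep_le (V := V) hJ
  have hρ := hpa.reO_mul_pow_mul_sliceRep hJ
  refine ⟨isUnit_map_sub hS hnorm, fun m hm v => ?_, fun n hn v s hs => ?_⟩
  · obtain ⟨k, rfl⟩ := Nat.exists_eq_add_of_le' hm
    have hsum := (summable_resolventTerm hS hnorm k).hasSum.mapL
      (ContinuousLinearMap.apply ℝ V v)
    simp only [ContinuousLinearMap.apply_apply, resolventTerm_sliceRep_apply] at hsum
    refine ⟨hsum.summable, piJ_eq_of_reO_sliceRep_eq hJ fun t => ?_⟩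
    rw [hsum.tsum_eq]
    exact congrArg (fun S : V →L[ℝ] V => S v) (mul_tsum_resolventTerm_eq hρ hS hnorm t k)
  · obtain ⟨k, rfl⟩ := Nat.exists_eq_add_of_le' hn
    obtain ⟨x', y', rfl⟩ := hs
    have ht : x' • (1 : Oct) + y' • J = toSlice J ⟨x', y'⟩ := rfl
    rw [ht, ← sliceRep_apply hJ]
    exact congrArg (fun S : V →L[ℝ] V => S v) (mul_inverse_pow_mul_map hρ hS hnorm ⟨x', y'⟩ k)
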